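/- Let K be a field of characteristic zero and n ≥ 1 an integer. Let M be the free K-vector space with basis {f_k : k ≥ 0} ∪ {e_k : k ≥ 0} and b : M → M the K-linear map with b(f_k) = 0, b(e_k) = f_{k−n} for k ≥ n, and b(e_k) = 0 for k < n. Let β : M × M → K be the symmetric bilinear form with β(e_i, e_j) = 1 if i + j = n − 1 and all other pairings of basis vectors equal to 0. Then β vanishes whenever one argument lies in the image of b, hence β induces a well-defined symmetric bilinear form on the homology ker(b)/im(b), and this induced form is non-degenerate on the n-dimensional homology spanned by the classes of e_0, …, e_{n−1}. -/

import Mathlib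

set_option maxHeartbeats 8000000
set_option synthInstance.maxHeartbeats 8000000

noncomputable section

open Finsupp

/-- The reduced Hochschild chain complex of `A_n` as a free vector space:
`Sum.inl k` indexes the even basis vector `f_k = 1|ε^k`,
`Sum.inr k` indexes the odd basis vector `e_k = ε|ε^k`. -/
abbrev MM (K : Type*) [Field K] := (ℕ ⊕ ℕ) →₀ K

/-- The even basis vectors `f_k`. -/
def fv (K : Type*) [Field K] (k : ℕ) : MM K := Finsupp.single (Sum.inl k) 1

/-- The odd basis vectors `e_k`. -/
def ev (K : Type*) [Field K] (k : ℕ) : MM K := Finsupp.single (Sum.inr k) 1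

/-- The Hochschild differential: `b f_k = 0`, `b e_k = f_{k-n}` if `k ≥ n`, else `0`. -/
def bmap (K : Type*) [Field K] (n : ℕ) : MM K →ₗ[K] MM K :=
  Finsupp.linearCombination K
    (Sum.elim (fun _ => (0 : MM K)) (fun k => if n ≤ k then fv K (k - n) else 0))

/-- Values of the Mukai pairing on basis vectors: `β(e_i, e_j) = 1` if `i + j = n - 1`,
all other pairings of basis vectors vanish. -/
def pairVal (K : Type*) [Field K] (n : ℕ) : (ℕ ⊕ ℕ) → (ℕ ⊕ ℕ) → K := fun i j =>
  match i, j with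
  | Sum.inr a, Sum.inr c => if a + c = n - 1 then 1 else 0
  | _, _ => 0

/-- The chain-level Mukai pairing, as a bilinear map. -/
def betaMap (K : Type*) [Field K] (n : ℕ) : MM K →ₗ[K] MM K →ₗ[K] K :=
  Finsupp.linearCombination K
    (fun i => Finsupp.linearCombination K (fun j => pairVal K n i j))

section

variable {K : Type*} [Field K]

theorem bmap_single_inl (n k : ℕ) (a : K) : bmap K n (single (Sum.inl k) a) = 0 := by
  simp [bmap]

theorem bmap_single_inr (n k : ℕ) (a : K) :
    bmap K n (single (Sum.inr k) a) = if n ≤ k then single (Sum.inl (k - n)) a else 0 := by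
  simp only [bmap, linearCombination_single, Sum.elim_inr, fv]
  split_ifs <;> simp

theorem betaMap_single_single (n : ℕ) (i j : ℕ ⊕ ℕ) (a c : K) :
    betaMap K n (single i a) (single j c) = a * (c * pairVal K n i j) := by
  simp [betaMap]

theorem pairVal_comm (n : ℕ) (i j : ℕ ⊕ ℕ) : pairVal K n i j = pairVal K n j i := by
  rcases i with i | i <;> rcases j with j | j <;> simp [pairVal, add_comm]

theorem betaMap_comm (n : ℕ) (x y : MM K) : betaMap K n x y = betaMap K n y x := by
  have h : betaMap K n = (betaMap K n).flip := by
    ext i j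
    simp [betaMap_single_single, pairVal_comm n i j]
  exact LinearMap.congr_fun₂ h x y

theorem betaMap_bmap (n : ℕ) (x y : MM K) : betaMap K n (bmap K n x) y = 0 := by
  have h : betaMap K n ∘ₗ bmap K n = 0 := by
    ext i j
    rcases i with i | i
    · simp [bmap_single_inl]
    · by_cases hi : n ≤ i <;> simp [bmap_single_inr, hi, betaMap_single_single, pairVal]
  exact LinearMap.congr_fun₂ h x y

/-- Pairing with `e_j` extracts the coefficient of `e_{n-1-j}`. -/
theorem betaMap_ev {n j : ℕ} (hj : j < n) (x : MM K) :
    betaMap K n x (ev K j) = x (Sum.inr (n - 1 - j)) := by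
  have h : (betaMap K n).flip (ev K j) = Finsupp.lapply (Sum.inr (n - 1 - j)) := by
    ext i
    rcases i with i | i
    · simp [ev, betaMap_single_single, pairVal]
    · have : i + j = n - 1 ↔ i = n - 1 - j := by omega
      simp [ev, betaMap_single_single, pairVal, this, Finsupp.single_apply]
  exact LinearMap.congr_fun h x

theorem bmap_apply_inl (n k : ℕ) (x : MM K) :
    bmap K n x (Sum.inl k) = x (Sum.inr (k + n)) := by
  have h : Finsupp.lapply (Sum.inl k) ∘ₗ bmap K n = Finsupp.lapply (Sum.inr (k + n)) := by
    ext i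
    rcases i with i | i
    · simp [bmap_single_inl]
    · by_cases hi : n ≤ i
      · have : i - n = k ↔ i = k + n := by omega
        simp [bmap_single_inr, hi, Finsupp.single_apply, this]
      · have : i ≠ k + n := by omega
        simp [bmap_single_inr, hi, this]
  exact LinearMap.congr_fun h x

theorem bmap_apply_inr (n k : ℕ) (x : MM K) : bmap K n x (Sum.inr k) = 0 := by
  have h : Finsupp.lapply (Sum.inr k) ∘ₗ bmap K n = 0 := by
    ext i
    rcases i with i | i
    · simp [bmap_single_inl]
    · by_cases hi : n ≤ i <;> simp [bmap_single_inr, hi]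
  exact LinearMap.congr_fun h x

theorem single_inl_mem_range_bmap (n k : ℕ) (a : K) :
    (single (Sum.inl k) a : MM K) ∈ LinearMap.range (bmap K n) :=
  ⟨single (Sum.inr (k + n)) a, by simp [bmap_single_inr]⟩

theorem mem_range_bmap_iff {n : ℕ} {x : MM K} :
    x ∈ LinearMap.range (bmap K n) ↔ ∀ k, x (Sum.inr k) = 0 := by
  constructor
  · rintro ⟨y, rfl⟩ k
    exact bmap_apply_inr n k y
  · intro h
    rw [← x.sum_single]
    refine Submodule.sum_mem _ fun i _ => ?_
    rcases i with i | i
    · exact single_inl_mem_range_bmap n i _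
    · simp [h i]

theorem mem_ker_bmap_iff {n : ℕ} {x : MM K} :
    x ∈ LinearMap.ker (bmap K n) ↔ ∀ k, n ≤ k → x (Sum.inr k) = 0 := by
  rw [LinearMap.mem_ker]
  constructor
  · intro h k hk
    have := bmap_apply_inl n (k - n) x
    rwa [h, Nat.sub_add_cancel hk, Finsupp.zero_apply, eq_comm] at this
  · intro h
    ext i
    rcases i with i | i
    · simpa [bmap_apply_inl] using h (i + n) (by omega)
    · exact bmap_apply_inr n i x

theorem ev_mem_ker_bmap {n k : ℕ} (hk : k < n) : ev K k ∈ LinearMap.ker (bmap K n) := by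
  simp [LinearMap.mem_ker, ev, bmap_single_inr, hk]

theorem range_bmap_le_ker (n : ℕ) : LinearMap.range (bmap K n) ≤ LinearMap.ker (bmap K n) :=
  fun _ hx => mem_ker_bmap_iff.2 fun k _ => mem_range_bmap_iff.1 hx k

theorem ker_bmap_eq (n : ℕ) : LinearMap.ker (bmap K n)
    = Submodule.span K (ev K '' {k | k < n}) ⊔ LinearMap.range (bmap K n) := by
  apply le_antisymm
  · intro x hx
    rw [← x.sum_single]
    refine Submodule.sum_mem _ fun i _ => ?_
    rcases i with i | i
    · exact Submodule.mem_sup_right (single_inl_mem_range_bmap n i _)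
    · by_cases hi : i < n
      · have h : (single (Sum.inr i) (x (Sum.inr i)) : MM K) = x (Sum.inr i) • ev K i := by
          simp [ev]
        rw [h]
        exact Submodule.mem_sup_left
          (Submodule.smul_mem _ _ (Submodule.subset_span ⟨i, hi, rfl⟩))
      · simp [mem_ker_bmap_iff.1 hx i (by omega)]
  · refine sup_le (Submodule.span_le.2 ?_) (range_bmap_le_ker n)
    rintro _ ⟨k, hk, rfl⟩
    exact ev_mem_ker_bmap hk

theorem mem_range_bmap_of_betaMap_eq_zero {n : ℕ} {x : MM K} (hx : x ∈ LinearMap.ker (bmap K n))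
    (h : ∀ y ∈ LinearMap.ker (bmap K n), betaMap K n x y = 0) :
    x ∈ LinearMap.range (bmap K n) := by
  refine mem_range_bmap_iff.2 fun k => ?_
  by_cases hk : k < n
  · have hj : n - 1 - k < n := by omega
    have := h _ (ev_mem_ker_bmap hj)
    rwa [betaMap_ev hj, show n - 1 - (n - 1 - k) = k by omega] at this
  · exact mem_ker_bmap_iff.1 hx k (by omega)

theorem eq_zero_of_sum_smul_ev_mem_range {n : ℕ} {c : Fin n → K}
    (h : (∑ k : Fin n, c k • ev K (k : ℕ)) ∈ LinearMap.range (bmap K n)) : c = 0 := by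
  funext i
  simpa [ev, Finsupp.finsetSum_apply, Finsupp.single_apply, Fin.val_inj] using
    mem_range_bmap_iff.1 h i

end

theorem stmt1 (K : Type*) [Field K] [CharZero K] (n : ℕ) (hn : 1 ≤ n) :
    -- β vanishes whenever one argument lies in the image of b
    (∀ x ∈ LinearMap.range (bmap K n), ∀ y : MM K,
        betaMap K n x y = 0 ∧ betaMap K n y x = 0) ∧
    -- β is symmetric
    (∀ x y : MM K, betaMap K n x y = betaMap K n y x) ∧
    -- hence β induces a well-defined symmetric bilinear form on homology;
    -- this induced form is non-degenerate on the homology: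
    (∀ x ∈ LinearMap.ker (bmap K n),
      (∀ y ∈ LinearMap.ker (bmap K n), betaMap K n x y = 0) →
        x ∈ LinearMap.range (bmap K n)) ∧
    -- the homology is n-dimensional, spanned by the classes of e_0, …, e_{n-1}:
    (∀ k, k < n → ev K k ∈ LinearMap.ker (bmap K n)) ∧
    LinearMap.ker (bmap K n)
      = Submodule.span K (ev K '' {k | k < n}) ⊔ LinearMap.range (bmap K n) ∧
    (∀ c : Fin n → K,
      (∑ k : Fin n, c k • ev K (k : ℕ)) ∈ LinearMap.range (bmap K n) → c = 0) := by
  exact ⟨fun x ⟨z, hz⟩ y => hz ▸ ⟨betaMap_bmap n z y, betaMap_comm n y _ ▸ betaMap_bmap n z y⟩,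
    betaMap_comm n, fun _ => mem_range_bmap_of_betaMap_eq_zero, fun _ => ev_mem_ker_bmap,
    ker_bmap_eq n, fun _ => eq_zero_of_sum_smul_ev_mem_range⟩
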